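/- Let S be the string rewriting system constructed from a given GPCP instance as described. For any indices j_1, …, j_k ∈ {1, …, n} (k ≥ 0), setting Z = c_{n+1} B c_{j_1} B c_{j_2} ⋯ B c_{j_k} B c_0, the Class I, II, III rules yield ¢_1 h_3(x_0 x_{j_k} ⋯ x_{j_1} x_{n+1}) Z →*_S λ and ¢_2 h_2(y_0 y_{j_k} ⋯ y_{j_1} y_{n+1}) Z →*_S λ. -/

import Mathlib

/-- The two-letter alphabet Γ = {a, b} of the GPCP instance. -/
inductive Γ : Type where
  | a : Γ
  | b : Γ

/-- The alphabet Σ̂ = {a₁,a₂,a₃,b₁,b₂,b₃,¢₁,¢₂,B} ∪ {c₀,…,c_{n+1}}. -/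
inductive Ltr (n : ℕ) : Type where
  | a1 : Ltr n
  | a2 : Ltr n
  | a3 : Ltr n
  | b1 : Ltr n
  | b2 : Ltr n
  | b3 : Ltr n
  | cent1 : Ltr n
  | cent2 : Ltr n
  | B : Ltr n
  | c : Fin (n + 2) → Ltr n

/-- The homomorphism h₁ : Γ* → Σ̂*, h₁(a) = a₁a₂a₃, h₁(b) = b₁b₂b₃. -/
def h1 {n : ℕ} (w : List Γ) : List (Ltr n) :=
  w.flatMap fun g => match g with
    | Γ.a => [Ltr.a1, Ltr.a2, Ltr.a3]
    | Γ.b => [Ltr.b1, Ltr.b2, Ltr.b3]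

/-- The homomorphism h₂ : Γ* → Σ̂*, h₂(a) = a₁a₂, h₂(b) = b₁b₂. -/
def h2 {n : ℕ} (w : List Γ) : List (Ltr n) :=
  w.flatMap fun g => match g with
    | Γ.a => [Ltr.a1, Ltr.a2]
    | Γ.b => [Ltr.b1, Ltr.b2]

/-- The homomorphism h₃ : Γ* → Σ̂*, h₃(a) = a₁, h₃(b) = b₁. -/
def h3 {n : ℕ} (w : List Γ) : List (Ltr n) :=
  w.flatMap fun g => match g with
    | Γ.a => [Ltr.a1]
    | Γ.b => [Ltr.b1]

/-- One-step rewrite relation of a string rewriting system `R`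
(a set of rules `(l, r)`): `u →_R v` iff `u = x l y` and `v = x r y`. -/
def OneStep {α : Type*} (R : Set (List α × List α)) (u v : List α) : Prop :=
  ∃ x y l r : List α, (l, r) ∈ R ∧ u = x ++ l ++ y ∧ v = x ++ r ++ y

/-- `u →*_R v`: reflexive-transitive closure of the one-step rewrite relation. -/
def RewStar {α : Type*} (R : Set (List α × List α)) : List α → List α → Prop :=
  Relation.ReflTransGen (OneStep R)

/-- `u ↔*_R v`: the Thue congruence, i.e. the reflexive-transitive-symmetric
closure of the one-step rewrite relation. -/
def ThueCong {α : Type*} (R : Set (List α × List α)) : List α → List α → Prop :=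
  Relation.EqvGen (OneStep R)

/-- The rules of the string rewriting system `S` constructed from the GPCP
instance with dominoes `(x i, y i)` for `i = 0, …, n+1`. -/
inductive SRule (n : ℕ) (x y : Fin (n + 2) → List Γ) :
    List (Ltr n) → List (Ltr n) → Prop where
  /- Class D rules -/
  | D1 (g : Γ) : SRule n x y ([Ltr.cent1] ++ h1 [g]) ([Ltr.cent1] ++ h3 [g])
  | D2 (g : Γ) : SRule n x y ([Ltr.cent2] ++ h1 [g]) ([Ltr.cent2] ++ h2 [g])
  | D3 (g g' : Γ) : SRule n x y (h2 [g] ++ h1 [g']) (h2 [g] ++ h2 [g'])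
  | D4 (g g' : Γ) : SRule n x y (h3 [g] ++ h1 [g']) (h3 [g] ++ h3 [g'])
  /- Class I rules -/
  | I1 : SRule n x y ([Ltr.cent1] ++ h3 (x 0) ++ [Ltr.B, Ltr.c 0]) []
  | I2 : SRule n x y ([Ltr.cent2] ++ h2 (y 0) ++ [Ltr.c 0]) []
  /- Class II rules -/
  | II1 (i : Fin (n + 2)) (hi : 1 ≤ (i : ℕ)) (hn : (i : ℕ) ≤ n) :
      SRule n x y (h3 (x i) ++ [Ltr.B, Ltr.c i]) []
  | II2 (i : Fin (n + 2)) (hi : 1 ≤ (i : ℕ)) (hn : (i : ℕ) ≤ n) :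
      SRule n x y (h2 (y i) ++ [Ltr.c i, Ltr.B]) []
  /- Class III rules -/
  | III1 : SRule n x y (h3 (x (Fin.last (n + 1))) ++ [Ltr.c (Fin.last (n + 1))]) []
  | III2 : SRule n x y (h2 (y (Fin.last (n + 1))) ++ [Ltr.c (Fin.last (n + 1)), Ltr.B]) []

/-- The string rewriting system `S` as a set of rules. -/
def SSys (n : ℕ) (x y : Fin (n + 2) → List Γ) : Set (List (Ltr n) × List (Ltr n)) :=
  {p | SRule n x y p.1 p.2}

/-- The GPCP instance `(x i, y i)_{i = 0,…,n+1}` (with start domino index `0`,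
end domino index `n+1` and intermediate dominoes `1,…,n`) has a solution:
a sequence of indices `i₁, …, i_k ∈ {1, …, n}` with
`x₀ x_{i₁} ⋯ x_{i_k} x_{n+1} = y₀ y_{i₁} ⋯ y_{i_k} y_{n+1}`. -/
def GPCPSolvable (n : ℕ) (x y : Fin (n + 2) → List Γ) : Prop :=
  ∃ L : List (Fin (n + 2)), (∀ i ∈ L, 1 ≤ (i : ℕ) ∧ (i : ℕ) ≤ n) ∧
    x 0 ++ L.flatMap x ++ x (Fin.last (n + 1)) =
      y 0 ++ L.flatMap y ++ y (Fin.last (n + 1))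

theorem h2_append {n : ℕ} (u v : List Γ) : (h2 (u ++ v) : List (Ltr n)) = h2 u ++ h2 v := by
  simp only [h2, List.flatMap_append]

theorem h3_append {n : ℕ} (u v : List Γ) : (h3 (u ++ v) : List (Ltr n)) = h3 u ++ h3 v := by
  simp only [h3, List.flatMap_append]

theorem h2_flatMap {n : ℕ} {ι : Type*} (L : List ι) (f : ι → List Γ) :
    (h2 (L.flatMap f) : List (Ltr n)) = L.flatMap fun i => h2 (f i) := by
  simp only [h2, List.flatMap_assoc]

theorem h3_flatMap {n : ℕ} {ι : Type*} (L : List ι) (f : ι → List Γ) :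
    (h3 (L.flatMap f) : List (Ltr n)) = L.flatMap fun i => h3 (f i) := by
  simp only [h3, List.flatMap_assoc]

/-- Moving a separator across a concatenation of separated words. -/
theorem List.flatMap_cons_append_singleton {ι α : Type*} (b : α) (f : ι → α) (L : List ι) :
    L.flatMap (fun i => [b, f i]) ++ [b] = [b] ++ L.flatMap (fun i => [f i, b]) := by
  induction L with
  | nil => rfl
  | cons i L ih => simp_all

theorem OneStep.erase {α : Type*} {R : Set (List α × List α)} {l : List α} (h : (l, []) ∈ R)
    (p q : List α) : OneStep R (p ++ l ++ q) (p ++ q) :=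
  ⟨p, q, l, [], h, rfl, by simp⟩

/-- A nest of factors `u i ⋯ v i`, each of which can be erased, can be erased from the inside
outwards. -/
theorem RewStar.erase_nested {ι α : Type*} {R : Set (List α × List α)} {u v : ι → List α}
    (L : List ι) (h : ∀ i ∈ L, (u i ++ v i, []) ∈ R) (p q : List α) :
    RewStar R (p ++ (L.reverse.flatMap u ++ L.flatMap v) ++ q) (p ++ q) := by
  induction L with
  | nil => simpa [RewStar] using Relation.ReflTransGen.refl
  | cons i L ih =>
    refine Relation.ReflTransGen.head ?_ (ih fun j hj => h j (List.mem_cons_of_mem i hj))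
    convert OneStep.erase (h i List.mem_cons_self) (p ++ L.reverse.flatMap u)
      (L.flatMap v ++ q) using 1 <;> simp

/-- For indices `j₁, …, j_k ∈ {1, …, n}` and
`Z = c_{n+1} B c_{j₁} B c_{j₂} ⋯ B c_{j_k} B c₀`, the Class I, II, III rules
yield `¢₁ h₃(x₀ x_{j_k} ⋯ x_{j₁} x_{n+1}) Z →*_S λ` and
`¢₂ h₂(y₀ y_{j_k} ⋯ y_{j₁} y_{n+1}) Z →*_S λ`. -/
theorem erasing_reductions (n : ℕ) (x y : Fin (n + 2) → List Γ)
    (hx : ∀ i, x i ≠ []) (hy : ∀ i, y i ≠ [])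
    (L : List (Fin (n + 2))) (hL : ∀ j ∈ L, 1 ≤ (j : ℕ) ∧ (j : ℕ) ≤ n)
    (Z : List (Ltr n))
    (hZ : Z = [Ltr.c (Fin.last (n + 1))] ++
      L.flatMap (fun j => [Ltr.B, Ltr.c j]) ++ [Ltr.B, Ltr.c 0]) :
    RewStar (SSys n x y)
      ([Ltr.cent1] ++ h3 (x 0 ++ L.reverse.flatMap x ++ x (Fin.last (n + 1))) ++ Z) [] ∧
    RewStar (SSys n x y)
      ([Ltr.cent2] ++ h2 (y 0 ++ L.reverse.flatMap y ++ y (Fin.last (n + 1))) ++ Z) [] := by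
  subst hZ
  constructor
  · have inner := OneStep.erase (R := SSys n x y) SRule.III1
      ([Ltr.cent1] ++ h3 (x 0) ++ L.reverse.flatMap fun i => h3 (x i))
      (L.flatMap (fun i => [Ltr.B, Ltr.c i]) ++ [Ltr.B, Ltr.c 0])
    have middle := RewStar.erase_nested (R := SSys n x y) L
      (fun i hi => SRule.II1 i (hL i hi).1 (hL i hi).2)
      ([Ltr.cent1] ++ h3 (x 0)) [Ltr.B, Ltr.c 0]
    have outer := OneStep.erase (R := SSys n x y) SRule.I1 [] []
    simp only [h3_append, h3_flatMap, List.append_assoc, List.nil_append, List.append_nil]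
      at inner middle outer ⊢
    exact .head inner (middle.tail outer)
  · have inner := OneStep.erase (R := SSys n x y) SRule.III2
      ([Ltr.cent2] ++ h2 (y 0) ++ L.reverse.flatMap fun i => h2 (y i))
      (L.flatMap (fun i => [Ltr.c i, Ltr.B]) ++ [Ltr.c 0])
    have middle := RewStar.erase_nested (R := SSys n x y) L
      (fun i hi => SRule.II2 i (hL i hi).1 (hL i hi).2)
      ([Ltr.cent2] ++ h2 (y 0)) [Ltr.c 0]
    have outer := OneStep.erase (R := SSys n x y) SRule.I2 [] []
    have shift : [Ltr.c (Fin.last (n + 1))] ++ L.flatMap (fun j => [Ltr.B, Ltr.c j]) ++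
          [Ltr.B, Ltr.c 0] =
        [Ltr.c (Fin.last (n + 1)), Ltr.B] ++ (L.flatMap (fun j => [Ltr.c j, Ltr.B]) ++
          [Ltr.c 0]) := by
      simpa using congrArg (· ++ [Ltr.c 0]) (List.flatMap_cons_append_singleton Ltr.B Ltr.c L)
    rw [shift]
    simp only [h2_append, h2_flatMap, List.append_assoc, List.nil_append, List.append_nil]
      at inner middle outer ⊢
    exact .head inner (middle.tail outer)
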